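/- The capacity satisfies C_H(A, αA) = max over all distributions P_X̄ on R(H) of I(X̄; X̄ + Z), where the maximum is restricted to distributions satisfying E[ A·s_𝕌 + ‖H_𝕌^{-1}(E[X̄ | 𝕌] − v_𝕌)‖₁ ] ≤ αA, with 𝕌 a deterministic function of X̄ taking values in 𝒰 such that 𝕌 = U implies X̄ ∈ v_U + D_U. -/

import Mathlib

open MeasureTheory ProbabilityTheory Matrix Filter Topology
open scoped ENNReal NNReal BigOperators

noncomputable section

namespace MimoOptical

variable {nt nr : ℕ}

/-- The law of a standard Gaussian vector `Z ~ N(0, I_n)` on `ℝ^n`. -/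
def stdGaussian (n : ℕ) : Measure (Fin n → ℝ) :=
  Measure.pi fun _ => gaussianReal 0 1

/-- Real-valued Kullback–Leibler divergence `∫ log (dμ/dν) dμ`
(with junk value if not absolutely continuous or not integrable). -/
def klDivR {Ω : Type*} [MeasurableSpace Ω] (μ ν : Measure Ω) : ℝ :=
  ∫ ω, Real.log (μ.rnDeriv ν ω).toReal ∂μ

/-- Mutual information of a joint law on a product space: the KL divergence between
the joint law and the product of its marginals. -/
def mutualInfoJoint {β γ : Type*} [MeasurableSpace β] [MeasurableSpace γ]
    (π : Measure (β × γ)) : ℝ :=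
  klDivR π ((π.map Prod.fst).prod (π.map Prod.snd))

/-- Joint law of `(X, H X + Z)` where `X ~ μ` and `Z ~ N(0, I_nr)` is independent of `X`. -/
def jointLaw (H : Matrix (Fin nr) (Fin nt) ℝ) (μ : Measure (Fin nt → ℝ)) :
    Measure ((Fin nt → ℝ) × (Fin nr → ℝ)) :=
  (μ.prod (stdGaussian nr)).map (fun p => (p.1, H.mulVec p.1 + p.2))

/-- An admissible input distribution: a probability measure on `[0, A]^nt`
with average power `E[‖X‖₁] ≤ avg`. -/
def Admissible (nt : ℕ) (A avg : ℝ) (μ : Measure (Fin nt → ℝ)) : Prop :=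
  IsProbabilityMeasure μ ∧ (∀ᵐ x ∂μ, ∀ k, x k ∈ Set.Icc (0 : ℝ) A) ∧
    (∫ x, ∑ k, |x k| ∂μ) ≤ avg

/-- Capacity of the MIMO optical intensity channel with peak power `A` and
average power `avg`. -/
def capacity (H : Matrix (Fin nr) (Fin nt) ℝ) (A avg : ℝ) : ℝ :=
  sSup { c | ∃ μ : Measure (Fin nt → ℝ),
    Admissible nt A avg μ ∧ c = mutualInfoJoint (jointLaw H μ) }

/-- The zonotope `R(M) = { M λ : λ ∈ [0,A]^k }`. -/
def zonotope {n k : ℕ} (M : Matrix (Fin n) (Fin k) ℝ) (A : ℝ) : Set (Fin n → ℝ) :=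
  { x | ∃ lam : Fin k → ℝ, (∀ i, lam i ∈ Set.Icc 0 A) ∧ x = M.mulVec lam }

/-- The collection `𝒰` of `nr`-element subsets of columns that are linearly independent. -/
def goodSets (H : Matrix (Fin nr) (Fin nt) ℝ) : Set (Finset (Fin nt)) :=
  { U | U.card = nr ∧ LinearIndependent ℝ (fun j : {x // x ∈ U} => fun i => H i j.1) }

/-- The square matrix `H_U` whose columns are the columns of `H` indexed by `U`
(junk value, the identity, if `U.card ≠ nr`). -/
def HU (H : Matrix (Fin nr) (Fin nt) ℝ) (U : Finset (Fin nt)) :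
    Matrix (Fin nr) (Fin nr) ℝ :=
  if h : U.card = nr then H.submatrix id (fun i => U.orderEmbOfFin h i) else 1

/-- `a_{U,j} = 1ᵀ H_U⁻¹ h_j`. -/
def aUj (H : Matrix (Fin nr) (Fin nt) ℝ) (U : Finset (Fin nt)) (j : Fin nt) : ℝ :=
  ∑ i, ((HU H U)⁻¹).mulVec (fun r => H r j) i

/-- `g_{U,j} = 1` if `a_{U,j} > 1` and `0` otherwise. -/
def gUj (H : Matrix (Fin nr) (Fin nt) ℝ) (U : Finset (Fin nt)) (j : Fin nt) : ℝ :=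
  if 1 < aUj H U j then 1 else 0

/-- `s_U = Σ_{j ∈ Uᶜ} g_{U,j}`. -/
def sU (H : Matrix (Fin nr) (Fin nt) ℝ) (U : Finset (Fin nt)) : ℝ :=
  ∑ j ∈ Uᶜ, gUj H U j

/-- `v_U = A Σ_{j ∈ Uᶜ} g_{U,j} h_j`. -/
def vU (H : Matrix (Fin nr) (Fin nt) ℝ) (A : ℝ) (U : Finset (Fin nt)) : Fin nr → ℝ :=
  fun r => A * ∑ j ∈ Uᶜ, gUj H U j * H r j

/-- The parallelepiped `D_U = R(H_U)`. -/
def DU (H : Matrix (Fin nr) (Fin nt) ℝ) (A : ℝ) (U : Finset (Fin nt)) :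
    Set (Fin nr → ℝ) :=
  zonotope (HU H U) A

/-- The shifted parallelepiped `v_U + D_U`. -/
def cell (H : Matrix (Fin nr) (Fin nt) ℝ) (A : ℝ) (U : Finset (Fin nt)) :
    Set (Fin nr → ℝ) :=
  (fun d => vU H A U + d) '' DU H A U

/-- `V_H = Σ_{U ∈ 𝒰} |det H_U|`. -/
def VH (H : Matrix (Fin nr) (Fin nt) ℝ) : ℝ :=
  ∑ᶠ U ∈ goodSets H, |(HU H U).det|

/-- `q_U = |det H_U| / V_H`. -/
def qU (H : Matrix (Fin nr) (Fin nt) ℝ) (U : Finset (Fin nt)) : ℝ :=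
  |(HU H U).det| / VH H

/-- `α_th = nr/2 + Σ_{U ∈ 𝒰} s_U q_U`. -/
def alphaTh (H : Matrix (Fin nr) (Fin nt) ℝ) : ℝ :=
  (nr : ℝ) / 2 + ∑ᶠ U ∈ goodSets H, sU H U * qU H U

/-- A probability vector on `𝒰`. -/
def ProbVec (H : Matrix (Fin nr) (Fin nt) ℝ) (p : Finset (Fin nt) → ℝ) : Prop :=
  (∀ U, 0 ≤ p U) ∧ (∀ U, U ∉ goodSets H → p U = 0) ∧ (∑ᶠ U ∈ goodSets H, p U) = 1

/-- Kullback–Leibler divergence `D(p‖q)` between probability vectors on `𝒰`. -/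
def Dkl (H : Matrix (Fin nr) (Fin nt) ℝ) (p q : Finset (Fin nt) → ℝ) : ℝ :=
  ∑ᶠ U ∈ goodSets H, p U * Real.log (p U / q U)

/-- `σ_{U,ℓ}`: square root of the `ℓ`-th diagonal entry of `H_U⁻¹ (H_U⁻¹)ᵀ`. -/
def sigmaUl (H : Matrix (Fin nr) (Fin nt) ℝ) (U : Finset (Fin nt)) (ℓ : Fin nr) : ℝ :=
  Real.sqrt ((((HU H U)⁻¹) * ((HU H U)⁻¹)ᵀ) ℓ ℓ)

/-- The trace of the covariance matrix of `X̄ = H X` when `X ~ μ`. -/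
def traceCov (H : Matrix (Fin nr) (Fin nt) ℝ) (μ : Measure (Fin nt → ℝ)) : ℝ :=
  ∑ i, ((∫ x, (H.mulVec x i) ^ 2 ∂μ) - (∫ x, H.mulVec x i ∂μ) ^ 2)

/-- The Gaussian Q-function. -/
def Qf (x : ℝ) : ℝ :=
  ∫ t in Set.Ioi x, Real.exp (-t ^ 2 / 2) / Real.sqrt (2 * Real.pi)

/-- The high-SNR penalty `ν` due to the average-power constraint. -/
def nuVal (H : Matrix (Fin nr) (Fin nt) ℝ) (α : ℝ) : ℝ :=
  sSup { y | ∃ lam mu : ℝ,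
    lam ∈ Set.Ioo (max 0 ((nr : ℝ) / 2 + α - alphaTh H)) (min ((nr : ℝ) / 2) α) ∧
    0 < mu ∧
    1 / mu - Real.exp (-mu) / (1 - Real.exp (-mu)) = lam / (nr : ℝ) ∧
    y = (nr : ℝ) * (1 - Real.log (mu / (1 - Real.exp (-mu)))
          - mu * Real.exp (-mu) / (1 - Real.exp (-mu)))
        - sInf { d | ∃ p : Finset (Fin nt) → ℝ, ProbVec H p ∧
            (∑ᶠ U ∈ goodSets H, p U * sU H U) = α - lam ∧ d = Dkl H p (qU H) } }

end MimoOptical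

/-- Joint law of `(X̄, X̄ + Z)` where `X̄ ~ ν` and `Z ~ N(0, I_nr)` independent of `X̄`. -/
def MimoOptical.jointLawBar {nr : ℕ} (ν : Measure (Fin nr → ℝ)) :
    Measure ((Fin nr → ℝ) × (Fin nr → ℝ)) :=
  (ν.prod (MimoOptical.stdGaussian nr)).map (fun p => (p.1, p.1 + p.2))

/-- Conditional mean `E[X̄ | X̄ ∈ s]` of `ν` on a set `s`, componentwise. -/
def MimoOptical.condMean {nr : ℕ} (ν : Measure (Fin nr → ℝ)) (s : Set (Fin nr → ℝ)) :
    Fin nr → ℝ :=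
  fun r => ∫ x, x r ∂(ν[|s])

namespace MimoOptical

lemma pi_ac {n : ℕ} (μ ν : Measure ℝ) [SigmaFinite μ] [SigmaFinite ν] (h : μ ≪ ν) :
    (Measure.pi fun _ : Fin n => μ) ≪ (Measure.pi fun _ : Fin n => ν) := by
  induction n with
  | zero =>
    rw [Measure.pi_of_empty, Measure.pi_of_empty]
  | succ n ih =>
    have h1 := ((measurePreserving_piFinSuccAbove (fun _ : Fin (n+1) => μ) 0).symm).map_eq
    have h2 := ((measurePreserving_piFinSuccAbove (fun _ : Fin (n+1) => ν) 0).symm).map_eq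
    rw [← h1, ← h2]
    exact (h.prod ih).map (MeasurableEquiv.measurable _)

lemma stdGaussian_ac (n : ℕ) : stdGaussian n ≪ (volume : Measure (Fin n → ℝ)) := by
  rw [volume_pi]
  exact pi_ac _ _ (gaussianReal_absolutelyContinuous 0 one_ne_zero)

lemma ac_stdGaussian (n : ℕ) : (volume : Measure (Fin n → ℝ)) ≪ stdGaussian n := by
  rw [volume_pi]
  exact pi_ac _ _ (gaussianReal_absolutelyContinuous' 0 one_ne_zero)

instance (n : ℕ) : IsProbabilityMeasure (stdGaussian n) := by
  unfold stdGaussian; infer_instance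

/-- KL divergence is preserved by a sufficient statistic. -/
lemma klDivR_map {Ω Ω' : Type*} [MeasurableSpace Ω] [MeasurableSpace Ω']
    (π ρ : Measure Ω) [IsFiniteMeasure ρ] (T : Ω → Ω') (hT : Measurable T)
    (g : Ω' → ℝ≥0∞) (hg : Measurable g) (h : π = ρ.withDensity (fun x => g (T x))) :
    klDivR π ρ = klDivR (π.map T) (ρ.map T) := by
  have h' : π.map T = (ρ.map T).withDensity g := by
    ext s hs
    rw [Measure.map_apply hT hs, h, withDensity_apply _ (hT hs), withDensity_apply _ hs,
      setLIntegral_map hs hg hT]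
  have e1 : π.rnDeriv ρ =ᵐ[π] fun x => g (T x) := by
    have : π ≪ ρ := h ▸ withDensity_absolutelyContinuous _ _
    apply this.ae_le
    rw [h]
    exact Measure.rnDeriv_withDensity ρ (hg.comp hT)
  have e2 : (π.map T).rnDeriv (ρ.map T) =ᵐ[π.map T] g := by
    have : π.map T ≪ ρ.map T := h' ▸ withDensity_absolutelyContinuous _ _
    apply this.ae_le
    rw [h']
    exact Measure.rnDeriv_withDensity _ hg
  unfold klDivR
  rw [integral_congr_ae (g := fun x => Real.log (g (T x)).toReal)
      (e1.mono fun x hx => by simp only [hx]),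
    integral_congr_ae (μ := π.map T) (g := fun x => Real.log (g x).toReal)
      (e2.mono fun x hx => by simp only [hx]),
    integral_map hT.aemeasurable]
  exact (Real.measurable_log.comp hg.ennreal_toReal).aestronglyMeasurable

/-- Density of the joint law with respect to the product of marginals. -/
lemma joint_density {n : ℕ} {X : Type*} [MeasurableSpace X] (μ : Measure X)
    [IsProbabilityMeasure μ] (F : X → Fin n → ℝ) (hF : Measurable F)
    (P : Measure (Fin n → ℝ)) (hP : P = (μ.prod (stdGaussian n)).map (fun p => F p.1 + p.2)) :
    ∃ g : (Fin n → ℝ) × (Fin n → ℝ) → ℝ≥0∞, Measurable g ∧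
      (μ.prod (stdGaussian n)).map (fun p => (p.1, F p.1 + p.2)) =
        (μ.prod P).withDensity (fun q => g (F q.1, q.2)) := by
  have hPp : IsProbabilityMeasure P := by
    rw [hP]; exact Measure.isProbabilityMeasure_map (by fun_prop)
  have hac : (volume : Measure (Fin n → ℝ)) ≪ P := by
    refine Measure.AbsolutelyContinuous.mk fun s hs h0 => ?_
    rw [hP, Measure.map_apply (by fun_prop) hs,
      Measure.measure_prod_null ((by fun_prop : Measurable _) hs)] at h0
    obtain ⟨x, hx⟩ := h0.exists
    have := ac_stdGaussian n hx
    have h3 : (Prod.mk x ⁻¹' ((fun p : X × (Fin n → ℝ) => F p.1 + p.2) ⁻¹' s))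
      = (fun z => F x + z) ⁻¹' s := rfl
    rw [h3, measure_preimage_add] at this
    exact this
  set φ := (stdGaussian n).rnDeriv volume with hφ
  set r := (volume : Measure (Fin n → ℝ)).rnDeriv P with hr
  have hφm : Measurable φ := Measure.measurable_rnDeriv _ _
  have hrm : Measurable r := Measure.measurable_rnDeriv _ _
  have h1 : (volume : Measure (Fin n → ℝ)).withDensity φ = stdGaussian n :=
    Measure.withDensity_rnDeriv_eq _ _ (stdGaussian_ac n)
  have h2 : P.withDensity r = volume := Measure.withDensity_rnDeriv_eq _ _ hac
  refine ⟨fun q => r q.2 * φ (q.2 - q.1), by fun_prop, ?_⟩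
  ext s hs
  rw [← lintegral_indicator_one hs, ← lintegral_indicator_one hs]
  have hi : Measurable (s.indicator (1 : X × (Fin n → ℝ) → ℝ≥0∞)) :=
    measurable_one.indicator hs
  rw [lintegral_map hi (by fun_prop), lintegral_withDensity_eq_lintegral_mul _ (by fun_prop) hi,
    lintegral_prod _ (by fun_prop), lintegral_prod _ (by fun_prop)]
  refine lintegral_congr fun x => ?_
  have hi' : Measurable fun y => s.indicator (1 : X × (Fin n → ℝ) → ℝ≥0∞) (x, y) := by fun_prop
  calc ∫⁻ z, s.indicator (1 : X × (Fin n → ℝ) → ℝ≥0∞) (x, F x + z) ∂(stdGaussian n)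
      = ∫⁻ z, φ z * s.indicator (1 : X × (Fin n → ℝ) → ℝ≥0∞) (x, F x + z) := by
        rw [← h1, lintegral_withDensity_eq_lintegral_mul _ hφm (by fun_prop)]; rfl
    _ = ∫⁻ z, (fun y => φ (y - F x) * s.indicator (1 : X × (Fin n → ℝ) → ℝ≥0∞) (x, y))
          (F x + z) := by simp
    _ = ∫⁻ y, φ (y - F x) * s.indicator (1 : X × (Fin n → ℝ) → ℝ≥0∞) (x, y) := by
        rw [lintegral_add_left_eq_self
          (fun y => φ (y - F x) * s.indicator (1 : X × (Fin n → ℝ) → ℝ≥0∞) (x, y))]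
    _ = _ := by
        conv_lhs => rw [← h2]
        rw [lintegral_withDensity_eq_lintegral_mul _ hrm (by fun_prop)]
        simp [mul_assoc]

lemma mutualInfo_eq {nt nr : ℕ} (H : Matrix (Fin nr) (Fin nt) ℝ) (μ : Measure (Fin nt → ℝ))
    [IsProbabilityMeasure μ] :
    mutualInfoJoint (jointLaw H μ) = mutualInfoJoint (jointLawBar (μ.map H.mulVec)) := by
  have hF : Measurable H.mulVec := (Continuous.matrix_mulVec continuous_const continuous_id).measurable
  set P := (μ.prod (stdGaussian nr)).map (fun p => H.mulVec p.1 + p.2) with hP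
  have hF' : Measurable fun p : (Fin nt → ℝ) × (Fin nr → ℝ) => H.mulVec p.1 + p.2 := by fun_prop
  have hPp : IsProbabilityMeasure P := Measure.isProbabilityMeasure_map (by fun_prop)
  obtain ⟨g, hg, hd⟩ := joint_density μ H.mulVec hF P hP
  have hT : Measurable (Prod.map H.mulVec (id : (Fin nr → ℝ) → _)) := hF.prodMap measurable_id
  have hbar : jointLawBar (μ.map H.mulVec) = (jointLaw H μ).map (Prod.map H.mulVec id) := by
    unfold jointLawBar jointLaw
    have : (μ.map H.mulVec).prod (stdGaussian nr) =
        (μ.prod (stdGaussian nr)).map (Prod.map H.mulVec id) := by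
      rw [← Measure.map_prod_map _ _ hF measurable_id, Measure.map_id]
    rw [this, Measure.map_map (by fun_prop) hT, Measure.map_map hT (by fun_prop)]
    rfl
  have hf : (jointLaw H μ).map Prod.fst = μ := by
    unfold jointLaw
    rw [Measure.map_map (by fun_prop) (by fun_prop)]
    exact measurePreserving_fst.map_eq
  have hs : (jointLaw H μ).map Prod.snd = P := by
    unfold jointLaw
    rw [Measure.map_map (by fun_prop) (by fun_prop)]
    rfl
  unfold mutualInfoJoint
  rw [hbar, Measure.map_map (by fun_prop) hT, Measure.map_map (by fun_prop) hT]
  have e1 : (jointLaw H μ).map (Prod.fst ∘ Prod.map H.mulVec id) = μ.map H.mulVec := by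
    conv_rhs => rw [← hf]
    rw [Measure.map_map hF (by fun_prop)]; rfl
  have e2 : (jointLaw H μ).map (Prod.snd ∘ Prod.map H.mulVec id) = P := by
    rw [← hs]; rfl
  rw [e1, e2, hf, hs]
  have e3 : (μ.map H.mulVec).prod P = (μ.prod P).map (Prod.map H.mulVec id) := by
    rw [← Measure.map_prod_map _ _ hF measurable_id, Measure.map_id]
  rw [e3]
  exact klDivR_map _ _ _ hT g hg hd

end MimoOptical

namespace MimoOptical

section geometry

variable {nt nr : ℕ}

lemma HU_apply (H : Matrix (Fin nr) (Fin nt) ℝ) (U : Finset (Fin nt)) (h : U.card = nr)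
    (r i : Fin nr) : HU H U r i = H r (U.orderEmbOfFin h i) := by
  simp [HU, h]

lemma isUnit_HU (H : Matrix (Fin nr) (Fin nt) ℝ) (U : Finset (Fin nt)) (hU : U ∈ goodSets H) :
    IsUnit (HU H U).det := by
  obtain ⟨h, hli⟩ := hU
  rw [← Matrix.isUnit_iff_isUnit_det, ← Matrix.linearIndependent_cols_iff_isUnit]
  have := hli.comp (U.orderIsoOfFin h) (U.orderIsoOfFin h).injective
  have he : (HU H U).col = (fun j : {x // x ∈ U} => fun i => H i j.1) ∘ (U.orderIsoOfFin h) := by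
    ext i r
    simp [Matrix.col, HU_apply H U h]
  rw [he]
  exact this

lemma sum_split (U : Finset (Fin nt)) (h : U.card = nr) (f : Fin nt → ℝ) :
    ∑ j, f j = ∑ i, f (U.orderEmbOfFin h i) + ∑ j ∈ Uᶜ, f j := by
  rw [← Finset.sum_add_sum_compl U]
  congr 1
  conv_lhs => rw [← Finset.map_orderEmbOfFin_univ U h]
  rw [Finset.sum_map]; rfl

/-- The linear functional `y ↦ 1ᵀ H_U⁻¹ y` as a vector. -/
def wU (H : Matrix (Fin nr) (Fin nt) ℝ) (U : Finset (Fin nt)) : Fin nr → ℝ :=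
  (1 : Fin nr → ℝ) ᵥ* (HU H U)⁻¹

lemma sum_inv_mulVec (H : Matrix (Fin nr) (Fin nt) ℝ) (U : Finset (Fin nt)) (y : Fin nr → ℝ) :
    ∑ i, ((HU H U)⁻¹ *ᵥ y) i = wU H U ⬝ᵥ y := by
  rw [wU, ← Matrix.dotProduct_mulVec, one_dotProduct]

lemma aUj_eq (H : Matrix (Fin nr) (Fin nt) ℝ) (U : Finset (Fin nt)) (j : Fin nt) :
    aUj H U j = (wU H U ᵥ* H) j := by
  rw [aUj, sum_inv_mulVec]; rfl

lemma wU_HU (H : Matrix (Fin nr) (Fin nt) ℝ) (U : Finset (Fin nt)) (hU : U ∈ goodSets H) :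
    wU H U ᵥ* HU H U = 1 := by
  rw [wU, Matrix.vecMul_vecMul, Matrix.nonsing_inv_mul _ (isUnit_HU H U hU), Matrix.vecMul_one]

lemma aUj_self (H : Matrix (Fin nr) (Fin nt) ℝ) (U : Finset (Fin nt)) (hU : U ∈ goodSets H)
    (i : Fin nr) : aUj H U (U.orderEmbOfFin hU.1 i) = 1 := by
  rw [aUj_eq]
  have := congrFun (wU_HU H U hU) i
  rw [Pi.one_apply] at this
  rw [← this]
  simp [Matrix.vecMul, dotProduct, HU_apply H U hU.1]

/-- The energy lower bound / identity. -/
lemma cost_eq (H : Matrix (Fin nr) (Fin nt) ℝ) (A : ℝ) (U : Finset (Fin nt)) (hU : U ∈ goodSets H)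
    (lam : Fin nt → ℝ) :
    ∑ l, ((HU H U)⁻¹ *ᵥ (H *ᵥ lam - vU H A U)) l =
      ∑ i, lam (U.orderEmbOfFin hU.1 i) + ∑ j ∈ Uᶜ, (lam j - A * gUj H U j) * aUj H U j := by
  rw [sum_inv_mulVec, dotProduct_sub, Matrix.dotProduct_mulVec, dotProduct,
    sum_split U hU.1]
  simp_rw [← aUj_eq, aUj_self H U hU, one_mul, sub_mul, Finset.sum_sub_distrib]
  have : wU H U ⬝ᵥ vU H A U = ∑ j ∈ Uᶜ, A * gUj H U j * aUj H U j := by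
    simp_rw [aUj_eq, Matrix.vecMul, dotProduct, vU, Finset.mul_sum]
    rw [Finset.sum_comm]
    refine Finset.sum_congr rfl fun j _ => Finset.sum_congr rfl fun r _ => ?_
    ring
  rw [this]
  simp_rw [mul_comm (lam _)]
  ring

lemma cost_le (H : Matrix (Fin nr) (Fin nt) ℝ) (A : ℝ) (U : Finset (Fin nt)) (hU : U ∈ goodSets H)
    (lam : Fin nt → ℝ) (hl : ∀ j, lam j ∈ Set.Icc 0 A) :
    A * sU H U + ∑ l, ((HU H U)⁻¹ *ᵥ (H *ᵥ lam - vU H A U)) l ≤ ∑ j, lam j := by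
  rw [cost_eq H A U hU, sum_split U hU.1 lam, sU, Finset.mul_sum]
  have : ∑ j ∈ Uᶜ, (A * gUj H U j + (lam j - A * gUj H U j) * aUj H U j) ≤ ∑ j ∈ Uᶜ, lam j := by
    refine Finset.sum_le_sum fun j _ => ?_
    have := hl j
    unfold gUj
    split_ifs with h
    · nlinarith [this.1, this.2]
    · nlinarith [this.1, this.2, not_lt.mp h]
  rw [Finset.sum_add_distrib] at this
  linarith

lemma mem_cell_iff (H : Matrix (Fin nr) (Fin nt) ℝ) (A : ℝ) (U : Finset (Fin nt))
    (hU : U ∈ goodSets H) (x : Fin nr → ℝ) :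
    x ∈ cell H A U ↔ ∀ l, ((HU H U)⁻¹ *ᵥ (x - vU H A U)) l ∈ Set.Icc 0 A := by
  constructor
  · rintro ⟨d, ⟨lam, hl, rfl⟩, rfl⟩ l
    simp only [add_sub_cancel_left, Matrix.mulVec_mulVec,
      Matrix.nonsing_inv_mul _ (isUnit_HU H U hU), Matrix.one_mulVec]
    exact hl l
  · intro h
    refine ⟨_, ⟨_, h, rfl⟩, ?_⟩
    simp [Matrix.mulVec_mulVec, Matrix.mul_nonsing_inv _ (isUnit_HU H U hU)]

lemma isClosed_cell (H : Matrix (Fin nr) (Fin nt) ℝ) (A : ℝ) (U : Finset (Fin nt))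
    (hU : U ∈ goodSets H) : IsClosed (cell H A U) := by
  have : cell H A U = ⋂ l, (fun x => ((HU H U)⁻¹ *ᵥ (x - vU H A U)) l) ⁻¹' Set.Icc 0 A := by
    ext x
    rw [mem_cell_iff H A U hU]
    simp
  rw [this]
  refine isClosed_iInter fun l => isClosed_Icc.preimage ?_
  have : Continuous fun x => (HU H U)⁻¹ *ᵥ (x - vU H A U) :=
    Continuous.matrix_mulVec continuous_const (by fun_prop)
  exact (continuous_apply l).comp this

/-- Minimum-energy lift. -/
def lift (H : Matrix (Fin nr) (Fin nt) ℝ) (A : ℝ) (U : Finset (Fin nt)) (h : U.card = nr)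
    (x : Fin nr → ℝ) : Fin nt → ℝ :=
  Function.extend (U.orderEmbOfFin h) ((HU H U)⁻¹ *ᵥ (x - vU H A U)) (fun j => A * gUj H U j)

lemma lift_in (H : Matrix (Fin nr) (Fin nt) ℝ) (A : ℝ) (U : Finset (Fin nt)) (h : U.card = nr)
    (x : Fin nr → ℝ) (i : Fin nr) : lift H A U h x (U.orderEmbOfFin h i) =
      ((HU H U)⁻¹ *ᵥ (x - vU H A U)) i :=
  (U.orderEmbOfFin h).injective.extend_apply _ _ _

lemma lift_out (H : Matrix (Fin nr) (Fin nt) ℝ) (A : ℝ) (U : Finset (Fin nt)) (h : U.card = nr)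
    (x : Fin nr → ℝ) (j : Fin nt) (hj : j ∉ U) : lift H A U h x j = A * gUj H U j := by
  refine Function.extend_apply' _ _ _ ?_
  rintro ⟨i, rfl⟩
  exact hj (Finset.orderEmbOfFin_mem U h i)

lemma mem_cases (U : Finset (Fin nt)) (h : U.card = nr) (j : Fin nt) :
    (∃ i, j = U.orderEmbOfFin h i) ∨ j ∉ U := by
  by_cases hj : j ∈ U
  · left
    have : j ∈ Finset.map (U.orderEmbOfFin h).toEmbedding Finset.univ := by
      rw [Finset.map_orderEmbOfFin_univ]; exact hj
    simp only [Finset.mem_map, Finset.mem_univ, true_and] at this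
    obtain ⟨i, hi⟩ := this
    exact ⟨i, hi.symm⟩
  · exact Or.inr hj

lemma H_lift (H : Matrix (Fin nr) (Fin nt) ℝ) (A : ℝ) (U : Finset (Fin nt)) (hU : U ∈ goodSets H)
    (x : Fin nr → ℝ) : H *ᵥ (lift H A U hU.1 x) = x := by
  ext r
  have h1 : ((HU H U) *ᵥ ((HU H U)⁻¹ *ᵥ (x - vU H A U))) r = x r - vU H A U r := by
    rw [Matrix.mulVec_mulVec, Matrix.mul_nonsing_inv _ (isUnit_HU H U hU), Matrix.one_mulVec]
    rfl
  rw [Matrix.mulVec, dotProduct, sum_split U hU.1]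
  simp_rw [lift_in, ← HU_apply]
  rw [Finset.sum_congr (s₁ := Uᶜ) (g := fun j => H r j * (A * gUj H U j)) rfl fun j hj => by
    rw [lift_out H A U hU.1 x j (Finset.mem_compl.mp hj)]]
  have h2 : vU H A U r = ∑ j ∈ Uᶜ, H r j * (A * gUj H U j) := by
    rw [vU, Finset.mul_sum]
    exact Finset.sum_congr rfl fun j _ => by ring
  rw [← h2]
  change ((HU H U) *ᵥ ((HU H U)⁻¹ *ᵥ (x - vU H A U))) r + _ = _
  rw [h1]; ring

lemma sum_lift (H : Matrix (Fin nr) (Fin nt) ℝ) (A : ℝ) (U : Finset (Fin nt)) (hU : U ∈ goodSets H)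
    (x : Fin nr → ℝ) : ∑ j, lift H A U hU.1 x j =
      A * sU H U + ∑ l, ((HU H U)⁻¹ *ᵥ (x - vU H A U)) l := by
  rw [sum_split U hU.1]
  simp_rw [lift_in]
  rw [Finset.sum_congr (s₁ := Uᶜ) rfl fun j hj =>
    lift_out H A U hU.1 x j (Finset.mem_compl.mp hj), ← Finset.mul_sum, sU]
  ring

lemma lift_mem (H : Matrix (Fin nr) (Fin nt) ℝ) (A : ℝ) (hA : 0 < A) (U : Finset (Fin nt))
    (hU : U ∈ goodSets H) (x : Fin nr → ℝ) (hx : x ∈ cell H A U) (j : Fin nt) :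
    lift H A U hU.1 x j ∈ Set.Icc 0 A := by
  rcases mem_cases U hU.1 j with ⟨i, rfl⟩ | hj
  · rw [lift_in]; exact (mem_cell_iff H A U hU x).1 hx i
  · rw [lift_out _ _ _ _ _ _ hj, gUj]
    split_ifs <;> simp [hA.le]

/-- Rank condition: a nonzero vector is not orthogonal to all columns. -/
lemma exists_vecMul_ne (H : Matrix (Fin nr) (Fin nt) ℝ) (hrank : H.rank = nr) (d : Fin nr → ℝ)
    (hd : d ≠ 0) : ∃ j, (d ᵥ* H) j ≠ 0 := by
  by_contra! hc
  apply hd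
  have hli : LinearIndependent ℝ H.row := by
    rw [linearIndependent_iff_card_eq_finrank_span, Set.finrank, ← Matrix.rank_eq_finrank_span_row,
      hrank, Fintype.card_fin]
  have := Matrix.vecMul_injective_iff.2 hli
  apply this
  change d ᵥ* H = 0 ᵥ* H
  rw [Matrix.zero_vecMul]
  ext j; exact hc j

/-- Dual feasibility (complementary slackness). -/
def DualOK (H : Matrix (Fin nr) (Fin nt) ℝ) (A : ℝ) (lam : Fin nt → ℝ) (w : Fin nr → ℝ) : Prop :=
  ∀ j, (lam j < A → (w ᵥ* H) j ≤ 1) ∧ (0 < lam j → 1 ≤ (w ᵥ* H) j)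

lemma exists_vertex (H : Matrix (Fin nr) (Fin nt) ℝ) (hrank : H.rank = nr) (A : ℝ)
    (lam : Fin nt → ℝ) (w₀ : Fin nr → ℝ) (hw₀ : DualOK H A lam w₀) :
    ∃ w, DualOK H A lam w ∧
      Submodule.span ℝ (H.col '' {j | (w ᵥ* H) j = 1}) = ⊤ := by
  classical
  by_contra! hc
  have key : ∀ m : ℕ, ∃ w, DualOK H A lam w ∧
      m ≤ (Finset.univ.filter fun j => (w ᵥ* H) j = 1).card := by
    intro m
    induction m with
    | zero => exact ⟨w₀, hw₀, Nat.zero_le _⟩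
    | succ m ih =>
      obtain ⟨w, hw, hm⟩ := ih
      obtain ⟨f, hf, hker⟩ := Submodule.exists_le_ker_of_lt_top _ (lt_top_iff_ne_top.2 (hc w hw))
      set d : Fin nr → ℝ := fun r => f (Pi.single r 1) with hd
      have hfd : ∀ x, f x = d ⬝ᵥ x := by
        intro x
        rw [LinearMap.pi_apply_eq_sum_univ f x, dotProduct]
        refine Finset.sum_congr rfl fun r _ => ?_
        rw [smul_eq_mul, mul_comm, hd]
        congr 2
        ext k; simp [Pi.single_apply, eq_comm]
      have hd0 : d ≠ 0 := by
        intro h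
        apply hf
        ext x
        simp [hfd, h]
      have hdT : ∀ j, (w ᵥ* H) j = 1 → (d ᵥ* H) j = 0 := by
        intro j hj
        have := hker (Submodule.subset_span ⟨j, hj, rfl⟩)
        rw [LinearMap.mem_ker, hfd] at this
        exact this
      obtain ⟨j₁, hj₁⟩ := exists_vecMul_ne H hrank d hd0
      obtain ⟨j, hj, hmin⟩ := Finset.exists_min_image
        (Finset.univ.filter fun j => (d ᵥ* H) j ≠ 0)
        (fun j => |(1 - (w ᵥ* H) j) / (d ᵥ* H) j|) ⟨j₁, by simpa using hj₁⟩
      simp only [Finset.mem_filter, Finset.mem_univ, true_and] at hj hmin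
      set t := (1 - (w ᵥ* H) j) / (d ᵥ* H) j with ht
      have hbound : ∀ k, |t * (d ᵥ* H) k| ≤ |1 - (w ᵥ* H) k| := by
        intro k
        by_cases hk : (d ᵥ* H) k = 0
        · simp [hk]
        · have := hmin k hk
          rw [abs_div (1 - (w ᵥ* H) k), le_div_iff₀ (abs_pos.2 hk)] at this
          rwa [abs_mul]
      have hval : ∀ k, ((w + t • d) ᵥ* H) k = (w ᵥ* H) k + t * (d ᵥ* H) k := by
        intro k
        rw [Matrix.add_vecMul, Matrix.smul_vecMul]; rfl
      refine ⟨w + t • d, ?_, ?_⟩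
      · intro k
        rw [hval]
        have hb := hbound k
        have hwk := hw k
        constructor
        · intro hl
          have h1 := hwk.1 hl
          rw [abs_of_nonneg (a := 1 - (w ᵥ* H) k) (by linarith)] at hb
          linarith [(abs_le.1 hb).2]
        · intro hl
          have h1 := hwk.2 hl
          rw [abs_of_nonpos (a := 1 - (w ᵥ* H) k) (by linarith)] at hb
          linarith [(abs_le.1 hb).1]
      · refine lt_of_le_of_lt hm (Finset.card_lt_card ?_)
        rw [Finset.ssubset_iff_of_subset]
        · refine ⟨j, ?_, ?_⟩
          · simp only [Finset.mem_filter, Finset.mem_univ, true_and]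
            rw [hval, ht, div_mul_cancel₀ _ hj]; ring
          · simp only [Finset.mem_filter, Finset.mem_univ, true_and]
            intro h; exact hj (hdT j h)
        · intro k hk
          simp only [Finset.mem_filter, Finset.mem_univ, true_and] at hk ⊢
          rw [hval, hk, hdT k hk]; ring
  obtain ⟨w, _, hw⟩ := key (nt + 1)
  have := (Finset.univ.filter fun j => (w ᵥ* H) j = 1).card_le_univ
  rw [Fintype.card_fin] at this
  omega

lemma cell_of_dual (H : Matrix (Fin nr) (Fin nt) ℝ) (hrank : H.rank = nr) (A : ℝ)
    (htie : ∀ U ∈ goodSets H, ∀ j ∉ U, aUj H U j ≠ 1)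
    (lam : Fin nt → ℝ) (hl : ∀ j, lam j ∈ Set.Icc 0 A) (w₀ : Fin nr → ℝ)
    (hw₀ : DualOK H A lam w₀) : ∃ U ∈ goodSets H, H *ᵥ lam ∈ cell H A U := by
  classical
  obtain ⟨w, hw, hspan⟩ := exists_vertex H hrank A lam w₀ hw₀
  obtain ⟨b, hb, -, hspan', hli⟩ := exists_linearIndepOn_extension (K := ℝ) (v := H.col)
    (linearIndepOn_empty ℝ H.col) (Set.empty_subset {j | (w ᵥ* H) j = 1})
  have htop : Submodule.span ℝ (H.col '' b) = ⊤ := by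
    rw [eq_top_iff, ← hspan]
    exact Submodule.span_le.2 hspan'
  let U : Finset (Fin nt) := b.toFinset
  have hli' : LinearIndependent ℝ (fun j : {x // x ∈ U} => fun i => H i j.1) := by
    have h2 : LinearIndepOn ℝ H.col (U : Set (Fin nt)) := by simpa [U] using hli
    exact h2
  have hcard : U.card = nr := by
    have h1 := finrank_span_eq_card hli'
    have h2 : Set.range (fun j : {x // x ∈ U} => fun i => H i j.1) = H.col '' b := by
      ext y
      simp only [Set.mem_range, Subtype.exists, Set.mem_image, U, Set.mem_toFinset]
      constructor
      · rintro ⟨a, ha, rfl⟩; exact ⟨a, ha, rfl⟩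
      · rintro ⟨a, ha, rfl⟩; exact ⟨a, ha, rfl⟩
    rw [h2, htop, finrank_top, Module.finrank_fin_fun, Fintype.card_coe] at h1
    exact h1.symm
  have hU : U ∈ goodSets H := ⟨hcard, hli'⟩
  have hwU : w = wU H U := by
    have h1 : w ᵥ* HU H U = 1 := by
      ext i
      have : U.orderEmbOfFin hcard i ∈ b := by
        have := Finset.orderEmbOfFin_mem U hcard i
        exact Set.mem_toFinset.1 this
      have := hb this
      simp only [Set.mem_ofPred_eq, Matrix.vecMul, dotProduct] at this
      simp only [Matrix.vecMul, dotProduct, HU_apply H U hcard, Pi.one_apply]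
      exact this
    rw [wU, ← h1, Matrix.vecMul_vecMul, Matrix.mul_nonsing_inv _ (isUnit_HU H U hU),
      Matrix.vecMul_one]
  refine ⟨U, hU, _, ⟨fun i => lam (U.orderEmbOfFin hcard i), fun i => hl _, rfl⟩, ?_⟩
  ext r
  beta_reduce
  rw [Pi.add_apply, Matrix.mulVec, Matrix.mulVec, dotProduct, dotProduct, sum_split U hcard]
  simp_rw [HU_apply H U hcard]
  rw [add_comm]
  congr 1
  rw [vU, Finset.mul_sum]
  refine Finset.sum_congr rfl fun j hj => ?_
  have hne := htie U hU j (Finset.mem_compl.1 hj)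
  have hwj := hw j
  rw [hwU, ← aUj_eq] at hwj
  have hlj := hl j
  unfold gUj
  split_ifs with h
  · have : lam j = A := by
      by_contra hne'
      exact absurd (hwj.1 (lt_of_le_of_ne hlj.2 hne')) (not_le.2 h)
    rw [this]; ring
  · have : lam j = 0 := by
      by_contra hne'
      have := hwj.2 (lt_of_le_of_ne hlj.1 (Ne.symm hne'))
      exact hne (le_antisymm (not_lt.1 h) this)
    rw [this]; ring

lemma nonneg_of_small (a c s : ℝ) (hs : 0 < s) (hc : 0 ≤ c)
    (h : ∀ t, 0 < t → t ≤ s → 0 ≤ t * a + t ^ 2 * c) : 0 ≤ a := by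
  by_contra! ha
  set t := min s (-a / (2 * (c + 1))) with ht
  have hq : 0 < -a / (2 * (c + 1)) := div_pos (by linarith) (by linarith)
  have htp : 0 < t := lt_min hs hq
  have h1 := h t htp (min_le_left _ _)
  have h2 : t ≤ -a / (2 * (c + 1)) := min_le_right _ _
  rw [le_div_iff₀ (by linarith)] at h2
  have h3 : 0 ≤ t * (a + t * c) := by nlinarith
  have h4 : 0 ≤ a + t * c := nonneg_of_mul_nonneg_right h3 htp
  nlinarith

lemma exists_penalized (H : Matrix (Fin nr) (Fin nt) ℝ) (A : ℝ) (hA : 0 < A)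
    (x : Fin nr → ℝ) (hx : x ∈ zonotope H A) (ε : ℝ) (hε : 0 < ε) :
    ∃ lam : Fin nt → ℝ, (∀ j, lam j ∈ Set.Icc 0 A) ∧ (∃ w, DualOK H A lam w) ∧
      ∑ r, (x r - (H *ᵥ lam) r) ^ 2 ≤ 2 * ε * (nt * A) := by
  let f : (Fin nt → ℝ) → ℝ := fun lam => ∑ j, lam j + (∑ r, (x r - (H *ᵥ lam) r) ^ 2) / (2 * ε)
  have hcont : Continuous f := by
    have h1 : Continuous fun lam : Fin nt → ℝ => H *ᵥ lam :=
      Continuous.matrix_mulVec continuous_const continuous_id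
    have h2 : ∀ r, Continuous fun lam : Fin nt → ℝ => (H *ᵥ lam) r :=
      fun r => (continuous_apply r).comp h1
    fun_prop
  obtain ⟨l0, hl0, hxl⟩ := hx
  obtain ⟨lam, hlam, hmin⟩ := (isCompact_Icc (a := (0 : Fin nt → ℝ)) (b := fun _ => A)).exists_isMinOn
    ⟨l0, fun j => (hl0 j).1, fun j => (hl0 j).2⟩ hcont.continuousOn
  have hbox : ∀ j, lam j ∈ Set.Icc 0 A := fun j => ⟨hlam.1 j, hlam.2 j⟩
  refine ⟨lam, hbox, ⟨fun r => (x r - (H *ᵥ lam) r) / ε, ?_⟩, ?_⟩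
  · intro j
    set w : Fin nr → ℝ := fun r => (x r - (H *ᵥ lam) r) / ε with hw
    set c := (∑ r, H r j ^ 2) / (2 * ε) with hc
    have hc0 : 0 ≤ c := by positivity
    have hstep : ∀ t : ℝ, lam j + t ∈ Set.Icc 0 A →
        0 ≤ t * (1 - (w ᵥ* H) j) + t ^ 2 * c := by
      intro t ht
      have hmem : lam + t • (Pi.single j (1 : ℝ) : Fin nt → ℝ) ∈ Set.Icc (0 : Fin nt → ℝ) (fun _ => A) := by
        constructor <;> intro k <;> by_cases hk : k = j
        · subst hk; simpa using ht.1
        · simpa [hk] using (hbox k).1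
        · subst hk; simpa using ht.2
        · simpa [hk] using (hbox k).2
      have h1 : f lam ≤ f (lam + t • (Pi.single j (1 : ℝ) : Fin nt → ℝ)) := hmin hmem
      have h2 : f (lam + t • (Pi.single j (1 : ℝ) : Fin nt → ℝ)) - f lam
          = t * (1 - (w ᵥ* H) j) + t ^ 2 * c := by
        have e1 : ∑ k, (lam + t • (Pi.single j (1 : ℝ) : Fin nt → ℝ)) k = ∑ k, lam k + t := by
          simp [Finset.sum_add_distrib, Pi.single_apply]
        have e2 : ∀ r, (H *ᵥ (lam + t • (Pi.single j (1 : ℝ) : Fin nt → ℝ))) r = (H *ᵥ lam) r + t * H r j := by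
          intro r
          rw [Matrix.mulVec_add, Matrix.mulVec_smul, Matrix.mulVec_single_one]
          rfl
        simp only [f, e1, e2, Matrix.vecMul, dotProduct, hw, hc]
        have e3 : ∑ r, (x r - ((H *ᵥ lam) r + t * H r j)) ^ 2 =
            ∑ r, (x r - (H *ᵥ lam) r) ^ 2 - 2 * t * ∑ r, (x r - (H *ᵥ lam) r) * H r j
              + t ^ 2 * ∑ r, H r j ^ 2 := by
          rw [Finset.mul_sum, Finset.mul_sum, ← Finset.sum_sub_distrib, ← Finset.sum_add_distrib]
          exact Finset.sum_congr rfl fun r _ => by ring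
        have e4 : ∑ r, (x r - (H *ᵥ lam) r) / ε * H r j
            = (∑ r, (x r - (H *ᵥ lam) r) * H r j) / ε := by
          rw [Finset.sum_div]
          exact Finset.sum_congr rfl fun r _ => by ring
        rw [e3, e4]
        field_simp
        ring
      linarith
    constructor
    · intro hl
      have := nonneg_of_small (1 - (w ᵥ* H) j) c (A - lam j) (by linarith) hc0 (fun t ht hs =>
        hstep t ⟨by linarith [(hbox j).1], by linarith⟩)
      linarith
    · intro hl
      have := nonneg_of_small ((w ᵥ* H) j - 1) c (lam j) hl hc0 (fun t ht hs => by
        have := hstep (-t) ⟨by linarith, by linarith [(hbox j).2]⟩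
        nlinarith)
      linarith
  · have h1 : f lam ≤ f l0 := hmin ⟨fun j => (hl0 j).1, fun j => (hl0 j).2⟩
    have h2 : f l0 ≤ nt * A := by
      simp only [f, hxl]
      have : ∑ j, l0 j ≤ ∑ _j : Fin nt, A := Finset.sum_le_sum fun j _ => (hl0 j).2
      simpa using this
    have h3 : 0 ≤ ∑ j, lam j := Finset.sum_nonneg fun j _ => (hbox j).1
    have h4 : (∑ r, (x r - (H *ᵥ lam) r) ^ 2) / (2 * ε) ≤ nt * A := by
      simp only [f] at h1 h2
      linarith
    rw [div_le_iff₀ (by linarith)] at h4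
    linarith

/-- The cells cover the zonotope. -/
lemma zonotope_cover (H : Matrix (Fin nr) (Fin nt) ℝ) (hrank : H.rank = nr) (A : ℝ) (hA : 0 < A)
    (htie : ∀ U ∈ goodSets H, ∀ j ∉ U, aUj H U j ≠ 1)
    (x : Fin nr → ℝ) (hx : x ∈ zonotope H A) : ∃ U ∈ goodSets H, x ∈ cell H A U := by
  have hclosed : IsClosed (⋃ U ∈ goodSets H, cell H A U) :=
    (Set.toFinite (goodSets H)).isClosed_biUnion fun U hU => isClosed_cell H A U hU
  suffices h : x ∈ ⋃ U ∈ goodSets H, cell H A U by simpa using h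
  rw [← hclosed.closure_eq, Metric.mem_closure_iff]
  intro δ hδ
  have hN : 0 ≤ (nt : ℝ) * A := by positivity
  obtain ⟨lam, hl, ⟨w, hw⟩, hs⟩ := exists_penalized H A hA x hx (δ ^ 2 / (4 * (nt * A) + 1))
    (by positivity)
  obtain ⟨U, hU, hc⟩ := cell_of_dual H hrank A htie lam hl w hw
  refine ⟨H *ᵥ lam, by simpa using ⟨U, hU, hc⟩, ?_⟩
  rw [dist_pi_lt_iff hδ]
  intro r
  have h1 : (x r - (H *ᵥ lam) r) ^ 2 ≤ ∑ r, (x r - (H *ᵥ lam) r) ^ 2 :=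
    Finset.single_le_sum (f := fun r => (x r - (H *ᵥ lam) r) ^ 2)
      (fun _ _ => sq_nonneg _) (Finset.mem_univ r)
  have h2 : 2 * (δ ^ 2 / (4 * (nt * A) + 1)) * (nt * A) < δ ^ 2 := by
    rw [mul_div_assoc', div_mul_eq_mul_div, div_lt_iff₀ (by positivity)]
    nlinarith [sq_pos_of_pos hδ, mul_nonneg (sq_nonneg δ) hN]
  rw [Real.dist_eq]
  exact abs_lt_of_sq_lt_sq (by linarith) hδ.le

end geometry

end MimoOptical

namespace MimoOptical

section selection

variable {nt nr : ℕ}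

lemma measurable_select {X Y ι : Type*} [MeasurableSpace X] [MeasurableSpace Y] [Countable ι]
    (u : X → ι) (hu : ∀ U, MeasurableSet (u ⁻¹' {U})) (F : ι → X → Y)
    (hF : ∀ U, Measurable (F U)) : Measurable fun x => F (u x) x := by
  intro s hs
  have : (fun x => F (u x) x) ⁻¹' s = ⋃ U, u ⁻¹' {U} ∩ F U ⁻¹' s := by
    ext x; simp
  rw [this]
  exact MeasurableSet.iUnion fun U => (hu U).inter (hF U hs)

lemma exists_select {X ι : Type*} [MeasurableSpace X] [DecidableEq ι] (S : Finset ι) (i₀ : ι)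
    (C : ι → Set X) (hC : ∀ i ∈ S, MeasurableSet (C i)) :
    ∃ u : X → ι, (∀ i, MeasurableSet (u ⁻¹' {i})) ∧ (∀ x, u x ∈ S ∨ u x = i₀) ∧
      ∀ x, (∃ i ∈ S, x ∈ C i) → x ∈ C (u x) := by
  classical
  induction S using Finset.induction_on with
  | empty =>
    refine ⟨fun _ => i₀, fun i => MeasurableSet.const (i₀ = i), fun _ => Or.inr rfl, ?_⟩
    rintro x ⟨i, hi, _⟩
    simp at hi
  | insert a S ha ih =>
    obtain ⟨u, hu, hS, hc⟩ := ih fun i hi => hC i (Finset.mem_insert_of_mem hi)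
    have hCa := hC a (Finset.mem_insert_self a S)
    refine ⟨fun x => if x ∈ C a then a else u x, ?_, ?_, ?_⟩
    · intro i
      have : (fun x => if x ∈ C a then a else u x) ⁻¹' {i}
          = (if a = i then C a else ∅) ∪ ((C a)ᶜ ∩ u ⁻¹' {i}) := by
        ext x
        by_cases hi : a = i
        · subst hi; by_cases hx : x ∈ C a <;> simp [hx]
        · by_cases hx : x ∈ C a <;> simp [hx, hi]
      rw [this]
      refine MeasurableSet.union ?_ (hCa.compl.inter (hu i))
      split_ifs
      · exact hCa
      · exact MeasurableSet.empty
    · intro x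
      by_cases hx : x ∈ C a
      · simp [hx]
      · rcases hS x with h | h
        · simp [hx, h]
        · simp [hx, h]
    · rintro x ⟨i, hi, hxi⟩
      by_cases hx : x ∈ C a
      · simp [hx]
      · simp only [hx, if_false]
        apply hc
        rcases Finset.mem_insert.1 hi with rfl | hi
        · exact absurd hxi hx
        · exact ⟨i, hi, hxi⟩

/-- Energy of the minimum-energy lift. -/
def costF (H : Matrix (Fin nr) (Fin nt) ℝ) (A : ℝ) (U : Finset (Fin nt)) (x : Fin nr → ℝ) : ℝ :=
  A * sU H U + ∑ l, ((HU H U)⁻¹ *ᵥ (x - vU H A U)) l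

lemma measurable_coord (H : Matrix (Fin nr) (Fin nt) ℝ) (A : ℝ) (U : Finset (Fin nt))
    (l : Fin nr) : Measurable fun x => ((HU H U)⁻¹ *ᵥ (x - vU H A U)) l := by
  have : Continuous fun x => (HU H U)⁻¹ *ᵥ (x - vU H A U) :=
    Continuous.matrix_mulVec continuous_const (by fun_prop)
  exact ((continuous_apply l).comp this).measurable

lemma measurable_costF (H : Matrix (Fin nr) (Fin nt) ℝ) (A : ℝ) (U : Finset (Fin nt)) :
    Measurable (costF H A U) := by
  have := fun l => measurable_coord H A U l
  unfold costF
  fun_prop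

lemma cost_integral (H : Matrix (Fin nr) (Fin nt) ℝ) (A : ℝ)
    (ν : Measure (Fin nr → ℝ)) [IsProbabilityMeasure ν] (hν : ∀ᵐ x ∂ν, x ∈ zonotope H A)
    (u : (Fin nr → ℝ) → Finset (Fin nt)) (hu : ∀ U, MeasurableSet (u ⁻¹' {U}))
    (hg : ∀ x, u x ∈ goodSets H) (hc : ∀ x ∈ zonotope H A, x ∈ cell H A (u x)) :
    (∑ᶠ U ∈ goodSets H, (ν (u ⁻¹' {U})).toReal *
        (A * sU H U + ∑ l, |((HU H U)⁻¹.mulVec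
          (fun r => condMean ν (u ⁻¹' {U}) r - vU H A U r)) l|)) =
      ∫ x, costF H A (u x) x ∂ν := by
  classical
  have hintg : ∀ r, Integrable (fun x : Fin nr → ℝ => x r) ν := by
    intro r
    refine Integrable.of_bound (C := ∑ j, |H r j| * A)
      (measurable_pi_apply r).aestronglyMeasurable ?_
    filter_upwards [hν] with x hx
    obtain ⟨lam, hl, rfl⟩ := hx
    rw [Real.norm_eq_abs, Matrix.mulVec, dotProduct]
    refine (Finset.abs_sum_le_sum_abs _ _).trans (Finset.sum_le_sum fun j _ => ?_)
    rw [abs_mul, abs_of_nonneg (hl j).1]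
    exact mul_le_mul_of_nonneg_left (hl j).2 (abs_nonneg _)
  have hcoord : ∀ U l, Integrable (fun x => ((HU H U)⁻¹ *ᵥ (x - vU H A U)) l) ν := by
    intro U l
    simp only [Matrix.mulVec, dotProduct, Pi.sub_apply]
    exact integrable_finsetSum _ fun r _ => ((hintg r).sub (integrable_const _)).const_mul _
  have hcost : ∀ U, Integrable (costF H A U) ν := by
    intro U
    exact (integrable_const _).add (integrable_finsetSum _ fun l _ => hcoord U l)
  have hterm : ∀ U ∈ goodSets H, (ν (u ⁻¹' {U})).toReal *
        (A * sU H U + ∑ l, |((HU H U)⁻¹.mulVec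
          (fun r => condMean ν (u ⁻¹' {U}) r - vU H A U r)) l|) =
      ∫ x in u ⁻¹' {U}, costF H A (u x) x ∂ν := by
    intro U hU
    set E := u ⁻¹' {U} with hE
    have e0 : ∫ x in E, costF H A (u x) x ∂ν = ∫ x in E, costF H A U x ∂ν := by
      refine setIntegral_congr_fun (hu U) fun x hx => ?_
      have : u x = U := hx
      simp only [this]
    rw [e0]
    by_cases hz : ν E = 0
    · rw [hz, Measure.restrict_eq_zero.2 hz]; simp
    have hp : 0 < (ν E).toReal := ENNReal.toReal_pos hz (measure_ne_top _ _)
    have e1 : ∫ x in E, costF H A U x ∂ν = (ν E).toReal * (A * sU H U) +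
        ∑ l, ∫ x in E, ((HU H U)⁻¹ *ᵥ (x - vU H A U)) l ∂ν := by
      unfold costF
      rw [integral_add (integrable_const _)
        (integrable_finsetSum _ fun l _ => (hcoord U l).integrableOn),
        integral_finsetSum _ fun l _ => (hcoord U l).integrableOn]
      simp [Measure.real]
    rw [e1, mul_add, Finset.mul_sum]
    congr 1
    refine Finset.sum_congr rfl fun l _ => ?_
    have e2 : (ν E).toReal * ((HU H U)⁻¹.mulVec
          (fun r => condMean ν E r - vU H A U r)) l =
        ∫ x in E, ((HU H U)⁻¹ *ᵥ (x - vU H A U)) l ∂ν := by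
      simp only [Matrix.mulVec, dotProduct, Pi.sub_apply]
      have hi : ∀ r, Integrable (fun x : Fin nr → ℝ => (HU H U)⁻¹ l r * (x r - vU H A U r))
          (ν.restrict E) := fun r =>
        ((hintg r).integrableOn.sub (integrable_const _)).const_mul _
      rw [integral_finsetSum _ fun r _ => hi r, Finset.mul_sum]
      refine Finset.sum_congr rfl fun r _ => ?_
      rw [integral_const_mul, integral_sub (hintg r).integrableOn (integrable_const _)]
      simp only [condMean, ProbabilityTheory.cond, integral_smul_measure, integral_const,
        ENNReal.toReal_inv, smul_eq_mul, Measure.real, Measure.restrict_apply_univ]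
      field_simp
    have e3 : 0 ≤ ∫ x in E, ((HU H U)⁻¹ *ᵥ (x - vU H A U)) l ∂ν := by
      refine setIntegral_nonneg_of_ae_restrict ?_
      filter_upwards [ae_restrict_mem (hu U), ae_restrict_of_ae hν] with x hx hz
      have hxU : u x = U := hx
      have := hc x hz
      rw [hxU] at this
      exact ((mem_cell_iff H A U hU x).1 this l).1
    rw [← e2] at e3 ⊢
    rw [abs_of_nonneg (nonneg_of_mul_nonneg_right e3 hp)]
  have hcostu : Integrable (fun x => costF H A (u x) x) ν := by
    refine Integrable.mono' (integrable_finsetSum Finset.univ fun U _ => (hcost U).norm)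
      (measurable_select u hu _ (measurable_costF H A)).aestronglyMeasurable ?_
    exact Eventually.of_forall fun x => Finset.single_le_sum
      (f := fun U => ‖costF H A U x‖) (fun _ _ => norm_nonneg _) (Finset.mem_univ (u x))
  have huniv : (⋃ U, u ⁻¹' {U}) = Set.univ := by ext x; simp
  have e4 : ∫ x, costF H A (u x) x ∂ν = ∑ U, ∫ x in u ⁻¹' {U}, costF H A (u x) x ∂ν := by
    rw [← setIntegral_univ, ← huniv]
    refine integral_iUnion_fintype hu ?_ fun _ => hcostu.integrableOn
    intro U V hUV
    exact Disjoint.preimage _ (by simpa using hUV)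
  rw [e4, finsum_mem_congr rfl hterm, ← finsum_eq_sum_of_fintype]
  refine finsum_congr fun U => ?_
  by_cases hU : U ∈ goodSets H
  · simp [hU]
  · have : u ⁻¹' {U} = ∅ := by
      ext x
      simp only [Set.mem_preimage, Set.mem_singleton_iff, Set.mem_empty_iff_false, iff_false]
      rintro rfl
      exact hU (hg x)
    simp [hU, this]

/-- Total version of `lift`. -/
def liftT (H : Matrix (Fin nr) (Fin nt) ℝ) (A : ℝ) (U : Finset (Fin nt)) (x : Fin nr → ℝ) :
    Fin nt → ℝ :=
  if h : U.card = nr then lift H A U h x else 0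

lemma liftT_eq (H : Matrix (Fin nr) (Fin nt) ℝ) (A : ℝ) (U : Finset (Fin nt))
    (h : U.card = nr) : liftT H A U = lift H A U h := by
  ext x; simp [liftT, h]

lemma measurable_liftT (H : Matrix (Fin nr) (Fin nt) ℝ) (A : ℝ) (U : Finset (Fin nt)) :
    Measurable (liftT H A U) := by
  by_cases h : U.card = nr
  · rw [liftT_eq H A U h]
    refine measurable_pi_lambda _ fun j => ?_
    rcases mem_cases U h j with ⟨i, rfl⟩ | hj
    · simp_rw [lift_in]
      exact measurable_coord H A U i
    · simp_rw [lift_out H A U h _ j hj]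
      exact measurable_const
  · have : liftT H A U = fun _ => 0 := by ext x; simp [liftT, h]
    rw [this]; exact measurable_const

end selection

end MimoOptical

/-- Equivalent capacity expression in terms of the image vector `X̄`:
the capacity equals the supremum of `I(X̄; X̄ + Z)` over all probability distributions
on `R(H)` satisfying `E[A s_𝕌 + ‖H_𝕌⁻¹(E[X̄|𝕌] − v_𝕌)‖₁] ≤ αA`, where `𝕌` is a
deterministic function of `X̄` with values in `𝒰` such that `𝕌 = U` implies
`X̄ ∈ v_U + D_U`. -/
theorem MimoOptical.capacity_eq_sSup_barX
    (nt nr : ℕ) (hnr : 1 ≤ nr) (hntnr : nr < nt)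
    (H : Matrix (Fin nr) (Fin nt) ℝ) (hrank : H.rank = nr)
    (A α : ℝ) (hA : 0 < A) (hα : 0 < α)
    (htie : ∀ U ∈ MimoOptical.goodSets H, ∀ j ∉ U, MimoOptical.aUj H U j ≠ 1) :
    MimoOptical.capacity H A (α * A) =
      sSup { c | ∃ ν : Measure (Fin nr → ℝ), IsProbabilityMeasure ν ∧
        (∀ᵐ x ∂ν, x ∈ MimoOptical.zonotope H A) ∧
        (∃ u : (Fin nr → ℝ) → Finset (Fin nt),
          (∀ U, MeasurableSet (u ⁻¹' {U})) ∧
          (∀ x, u x ∈ MimoOptical.goodSets H) ∧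
          (∀ x ∈ MimoOptical.zonotope H A, x ∈ MimoOptical.cell H A (u x)) ∧
          (∑ᶠ U ∈ MimoOptical.goodSets H, (ν (u ⁻¹' {U})).toReal *
              (A * MimoOptical.sU H U +
                ∑ ℓ, |((MimoOptical.HU H U)⁻¹.mulVec
                  (fun r => MimoOptical.condMean ν (u ⁻¹' {U}) r
                    - MimoOptical.vU H A U r)) ℓ|)) ≤ α * A) ∧
        c = MimoOptical.mutualInfoJoint (MimoOptical.jointLawBar ν) } := by
  open MimoOptical in
  classical
  have hHm : Measurable H.mulVec :=
    (Continuous.matrix_mulVec continuous_const continuous_id).measurable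
  unfold capacity
  congr 1
  ext c
  constructor
  · rintro ⟨μ, ⟨hμp, hbox, havg⟩, rfl⟩
    have hz : ∀ᵐ x ∂μ, H.mulVec x ∈ zonotope H A := by
      filter_upwards [hbox] with x hx
      exact ⟨x, hx, rfl⟩
    obtain ⟨U₀, hU₀, -⟩ := zonotope_cover H hrank A hA htie (H.mulVec 0)
      ⟨0, fun i => ⟨le_rfl, hA.le⟩, rfl⟩
    obtain ⟨u, hu, hS, hc⟩ := exists_select (Set.toFinite (goodSets H)).toFinset U₀ (cell H A)
      (fun U hU => (isClosed_cell H A U (by simpa using hU)).measurableSet)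
    have hg : ∀ x, u x ∈ goodSets H := by
      intro x
      rcases hS x with h | h
      · simpa using h
      · rw [h]; exact hU₀
    have hc' : ∀ x ∈ zonotope H A, x ∈ cell H A (u x) := by
      intro x hx
      obtain ⟨U, hU, hxU⟩ := zonotope_cover H hrank A hA htie x hx
      exact hc x ⟨U, by simpa using hU, hxU⟩
    have hνp : IsProbabilityMeasure (μ.map H.mulVec) :=
      Measure.isProbabilityMeasure_map hHm.aemeasurable
    have hν : ∀ᵐ x ∂(μ.map H.mulVec), x ∈ zonotope H A := by
      have hzc : MeasurableSet (zonotope H A) := by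
        have : zonotope H A = H.mulVec '' Set.Icc (0 : Fin nt → ℝ) (fun _ => A) := by
          ext x
          constructor
          · rintro ⟨l, hl, rfl⟩
            exact ⟨l, ⟨fun j => (hl j).1, fun j => (hl j).2⟩, rfl⟩
          · rintro ⟨l, hl, rfl⟩
            exact ⟨l, fun j => ⟨hl.1 j, hl.2 j⟩, rfl⟩
        rw [this]
        exact (isCompact_Icc.image
          (Continuous.matrix_mulVec continuous_const continuous_id)).measurableSet
      exact (ae_map_iff (p := fun x => x ∈ zonotope H A) hHm.aemeasurable hzc).2 hz
    refine ⟨μ.map H.mulVec, hνp, hν, ⟨u, hu, hg, hc', ?_⟩, mutualInfo_eq H μ⟩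
    rw [cost_integral H A _ hν u hu hg hc']
    refine le_trans ?_ havg
    rw [integral_map hHm.aemeasurable
      (measurable_select u hu _ (measurable_costF H A)).aestronglyMeasurable]
    refine integral_mono_of_nonneg ?_ ?_ ?_
    · filter_upwards [hz] with x hx
      refine add_nonneg (mul_nonneg hA.le (Finset.sum_nonneg fun j _ => ?_))
        (Finset.sum_nonneg fun l _ => ?_)
      · unfold gUj; split_ifs <;> norm_num
      · exact ((mem_cell_iff H A _ (hg _) _).1 (hc' _ hx) l).1
    · refine integrable_finsetSum _ fun k _ => ?_
      refine Integrable.of_bound (C := A)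
        (continuous_apply k).abs.aestronglyMeasurable ?_
      filter_upwards [hbox] with x hx
      rw [Real.norm_eq_abs, abs_abs, abs_of_nonneg (hx k).1]
      exact (hx k).2
    · filter_upwards [hbox] with x hx
      refine (cost_le H A _ (hg (H.mulVec x)) x hx).trans (Finset.sum_le_sum fun k _ => le_abs_self _)
  · rintro ⟨ν, hνp, hν, ⟨u, hu, hg, hc, hle⟩, rfl⟩
    rw [cost_integral H A ν hν u hu hg hc] at hle
    let T : (Fin nr → ℝ) → Fin nt → ℝ := fun x => liftT H A (u x) x
    have hT : Measurable T := measurable_select u hu _ (measurable_liftT H A)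
    have hTe : ∀ x, T x = lift H A (u x) (hg x).1 x := fun x => by
      simp only [T]; rw [liftT_eq H A (u x) (hg x).1]
    have hHT : H.mulVec ∘ T = id := by
      ext1 x
      rw [Function.comp_apply, hTe]
      exact H_lift H A (u x) (hg x) x
    have hmem : ∀ᵐ x ∂ν, ∀ k, T x k ∈ Set.Icc (0 : ℝ) A := by
      filter_upwards [hν] with x hx k
      rw [hTe]
      exact lift_mem H A hA (u x) (hg x) x (hc x hx) k
    have hμp : IsProbabilityMeasure (ν.map T) := Measure.isProbabilityMeasure_map hT.aemeasurable
    refine ⟨ν.map T, ⟨hμp, ?_, ?_⟩, ?_⟩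
    · rw [ae_map_iff hT.aemeasurable]
      · exact hmem
      · have : {x : Fin nt → ℝ | ∀ k, x k ∈ Set.Icc (0 : ℝ) A}
            = ⋂ k, (fun x => x k) ⁻¹' Set.Icc (0 : ℝ) A := by ext x; simp
        rw [this]
        exact MeasurableSet.iInter fun k => measurable_pi_apply k measurableSet_Icc
    · rw [integral_map hT.aemeasurable (continuous_finsetSum _
        fun k _ => (continuous_apply k).abs).aestronglyMeasurable]
      refine le_of_eq_of_le (integral_congr_ae ?_) hle
      filter_upwards [hmem] with x hx
      rw [Finset.sum_congr rfl fun k _ => abs_of_nonneg (hx k).1, hTe]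
      exact sum_lift H A (u x) (hg x) x
    · rw [mutualInfo_eq, Measure.map_map hHm hT, hHT, Measure.map_id]
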